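/- Let k ≥ 1 be an integer, let r be meromorphic at 0 of order b′ < 0, set g = r^k, and let h be holomorphic on a neighborhood of 0. Then the following are equivalent: (i) there exist ρ > 0 and a holomorphic function f on B(0,ρ) with f(0) = 0 such that k·f′(z)·g(z) + f(z)·g′(z) = g(z)·h(z) for all z ∈ B(0,ρ)∖{0}; (ii) there exist ρ > 0 and a holomorphic function P on B(0,ρ)∖{0} with P′(z) = r(z)·h(z) for all z ∈ B(0,ρ)∖{0} (equivalently, the residue of r·h at 0 vanishes). -/

import Mathlib

/-- A function `r` is meromorphic at `0` of order `b′ ∈ ℤ` if on some punctured ball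
`B(0,ρ)∖{0}` one has `r(z) = z^{b′}·r̃(z)` with `r̃` holomorphic on `B(0,ρ)` and `r̃(0) ≠ 0`. -/
def MeromorphicAtZeroOfOrder (r : ℂ → ℂ) (b : ℤ) : Prop :=
  ∃ ρ > (0 : ℝ), ∃ rt : ℂ → ℂ,
    (∀ z ∈ Metric.ball (0 : ℂ) ρ, DifferentiableAt ℂ rt z) ∧ rt 0 ≠ 0 ∧
    ∀ z ∈ Metric.ball (0 : ℂ) ρ \ {0}, r z = z ^ b * rt z

lemma primitive_growth (n : ℕ) (hn : 1 ≤ n) (R : ℝ) (hR : 0 < R) (u P : ℂ → ℂ)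
    (hu : ∀ z ∈ Metric.ball (0 : ℂ) R, DifferentiableAt ℂ u z)
    (hP : ∀ z ∈ Metric.ball (0 : ℂ) R \ {0}, DifferentiableAt ℂ P z)
    (hP' : ∀ z ∈ Metric.ball (0 : ℂ) R \ {0}, z ^ n * deriv P z = u z) :
    ∃ δ > 0, δ ≤ R ∧ ∃ Q : ℂ → ℂ, (∀ z ∈ Metric.ball (0 : ℂ) δ, DifferentiableAt ℂ Q z) ∧
      Q 0 = 0 ∧ ∀ z ∈ Metric.ball (0 : ℂ) δ \ {0}, Q z = z ^ n * P z := by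
  obtain ⟨δ, hδ, hδR⟩ : ∃ δ, 0 < δ ∧ δ < R := exists_between hR
  refine ⟨δ, hδ, hδR.le, ?_⟩
  have hcl : Metric.closedBall (0 : ℂ) δ ⊆ Metric.ball 0 R := Metric.closedBall_subset_ball hδR
  obtain ⟨C, hC⟩ := (isCompact_closedBall (0 : ℂ) δ).exists_bound_of_continuousOn
    (f := u) (fun z hz => (hu z (hcl hz)).continuousAt.continuousWithinAt)
  obtain ⟨M, hM⟩ := (isCompact_sphere (0 : ℂ) δ).exists_bound_of_continuousOn
    (f := P) (fun z hz => (hP z ⟨hcl (Metric.sphere_subset_closedBall hz), by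
      rintro rfl
      simp at hz
      exact hδ.ne hz⟩).continuousAt.continuousWithinAt)
  have hC0 : 0 ≤ C := (norm_nonneg _).trans (hC 0 (by simp [hδ.le]))
  have hbound : ∀ z ∈ Metric.ball (0 : ℂ) δ \ {0}, ‖z ^ n * P z‖ ≤ C * δ + δ ^ n * M := by
    rintro z ⟨hz, hz0⟩
    have hz0 : z ≠ 0 := hz0
    have hzδ : ‖z‖ < δ := by simpa using hz
    have hzp : 0 < ‖z‖ := norm_pos_iff.mpr hz0
    set y : ℂ := ((δ / ‖z‖ : ℝ) : ℂ) * z with hy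
    have hyn : ‖y‖ = δ := by
      rw [hy, norm_mul, Complex.norm_real, Real.norm_of_nonneg (by positivity)]
      field_simp
    have hseg : ∀ w ∈ segment ℝ z y, ‖z‖ ≤ ‖w‖ ∧ ‖w‖ ≤ δ := by
      rintro w ⟨a, b, ha, hb, hab, rfl⟩
      have e : a • z + b • y = ((a + b * (δ / ‖z‖) : ℝ) : ℂ) * z := by
        simp only [hy, Complex.real_smul]
        push_cast
        ring
      rw [e, norm_mul, Complex.norm_real, Real.norm_of_nonneg (by positivity)]
      have e2 : (a + b * (δ / ‖z‖)) * ‖z‖ = a * ‖z‖ + b * δ := by field_simp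
      rw [e2]
      constructor
      · nlinarith
      · nlinarith
    have hmem : ∀ w ∈ segment ℝ z y, w ∈ Metric.ball (0 : ℂ) R \ {0} := by
      intro w hw
      obtain ⟨h1, h2⟩ := hseg w hw
      refine ⟨hcl (by simpa using h2), ?_⟩
      rintro rfl
      simp at h1
      exact hz0 h1
    have hd : ∀ w ∈ segment ℝ z y, ‖deriv P w‖ ≤ C / ‖z‖ ^ n := by
      intro w hw
      obtain ⟨h1, h2⟩ := hseg w hw
      have h3 := hC w (by simpa using h2)
      rw [← hP' w (hmem w hw), norm_mul, norm_pow] at h3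
      rw [le_div_iff₀ (by positivity)]
      calc ‖deriv P w‖ * ‖z‖ ^ n ≤ ‖deriv P w‖ * ‖w‖ ^ n := by gcongr
        _ ≤ C := by linarith
    have hmv := (convex_segment (𝕜 := ℝ) z y).norm_image_sub_le_of_norm_deriv_le
      (f := P) (fun w hw => hP w (hmem w hw)) hd (right_mem_segment ℝ z y)
      (left_mem_segment ℝ z y)
    have hzy : ‖z - y‖ ≤ δ := by
      have e : z - y = ((1 - δ / ‖z‖ : ℝ) : ℂ) * z := by
        simp only [hy]
        push_cast
        ring
      rw [e, norm_mul, Complex.norm_real, Real.norm_of_nonpos, neg_mul, sub_mul,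
        div_mul_cancel₀ _ hzp.ne']
      · linarith
      · rw [sub_nonpos, le_div_iff₀ hzp]
        linarith
    have hPy : ‖P y‖ ≤ M := hM y (by simpa using hyn)
    have hPz : ‖P z‖ ≤ C / ‖z‖ ^ n * δ + M := by
      have h1 : ‖P z‖ ≤ ‖P z - P y‖ + ‖P y‖ := by
        simpa using norm_add_le (P z - P y) (P y)
      have h2 : C / ‖z‖ ^ n * ‖z - y‖ ≤ C / ‖z‖ ^ n * δ := by gcongr
      linarith
    have hM0 : 0 ≤ M := (norm_nonneg _).trans hPy
    rw [norm_mul, norm_pow]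
    calc ‖z‖ ^ n * ‖P z‖ ≤ ‖z‖ ^ n * (C / ‖z‖ ^ n * δ + M) := by gcongr
      _ = C * δ + ‖z‖ ^ n * M := by field_simp
      _ ≤ C * δ + δ ^ n * M := by gcongr
  set Q := Function.update (fun z => z ^ n * P z) 0
    (Filter.limUnder (nhdsWithin (0 : ℂ) {0}ᶜ) (fun z => z ^ n * P z)) with hQ
  have hQd : DifferentiableOn ℂ Q (Metric.ball 0 δ) := by
    apply Complex.differentiableOn_update_limUnder_of_bddAbove (Metric.ball_mem_nhds _ hδ)
    · intro z hz
      exact ((differentiableAt_id.pow n).mul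
        (hP z ⟨hcl (Metric.ball_subset_closedBall hz.1), hz.2⟩)).differentiableWithinAt
    · refine ⟨C * δ + δ ^ n * M, ?_⟩
      rintro _ ⟨z, hz, rfl⟩
      exact hbound z hz
  have hQe : ∀ z : ℂ, z ≠ 0 → Q z = z ^ n * P z := fun z hz => by
    simp [hQ, Function.update_of_ne hz]
  refine ⟨Q, fun z hz => hQd.differentiableAt (Metric.isOpen_ball.mem_nhds hz), ?_,
    fun z hz => hQe z hz.2⟩
  have hde : ∀ z ∈ Metric.ball (0 : ℂ) δ \ {0}, z * deriv Q z - n * Q z - z * u z = 0 := by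
    intro z hz
    have hz0 : z ≠ 0 := hz.2
    have hzR : z ∈ Metric.ball (0 : ℂ) R \ {0} :=
      ⟨hcl (Metric.ball_subset_closedBall hz.1), hz.2⟩
    have hev : Q =ᶠ[nhds z] fun z => z ^ n * P z := by
      filter_upwards [isOpen_ne.mem_nhds hz0] with w hw using hQe w hw
    have h1 := ((hasDerivAt_pow n z).mul (hP z hzR).hasDerivAt)
    have h2 : deriv Q z = n * z ^ (n - 1) * P z + z ^ n * deriv P z := by
      rw [hev.deriv_eq]
      exact h1.deriv
    rw [h2, hQe z hz0, hP' z hzR]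
    obtain ⟨m, rfl⟩ : ∃ m, n = m + 1 := ⟨n - 1, by omega⟩
    simp only [Nat.add_sub_cancel, pow_succ]
    ring
  have h0 : (0 : ℂ) ∈ Metric.ball (0 : ℂ) δ := by simpa using hδ
  have hdc : ContinuousAt (deriv Q) 0 :=
    ((hQd.deriv Metric.isOpen_ball).differentiableAt
      (Metric.isOpen_ball.mem_nhds h0)).continuousAt
  have hQc : ContinuousAt Q 0 :=
    (hQd.differentiableAt (Metric.isOpen_ball.mem_nhds h0)).continuousAt
  have huc : ContinuousAt u 0 := (hu 0 (by simpa using hR)).continuousAt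
  have hc : ContinuousAt (fun z => z * deriv Q z - n * Q z - z * u z) 0 := by fun_prop
  have ht1 := hc.tendsto.mono_left (nhdsWithin_le_nhds (s := {0}ᶜ))
  have ht2 : Filter.Tendsto (fun z => z * deriv Q z - n * Q z - z * u z)
      (nhdsWithin 0 {0}ᶜ) (nhds 0) := by
    apply tendsto_const_nhds.congr'
    have : Metric.ball (0 : ℂ) δ \ {0} ∈ nhdsWithin (0 : ℂ) {0}ᶜ :=
      Filter.inter_mem (mem_nhdsWithin_of_mem_nhds (Metric.ball_mem_nhds _ hδ))
        self_mem_nhdsWithin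
    filter_upwards [this] with z hz using (hde z hz).symm
  have h3 := tendsto_nhds_unique ht1 ht2
  have hn0 : (n : ℂ) ≠ 0 := by exact_mod_cast (by omega : n ≠ 0)
  simpa [hn0, show n ≠ 0 by omega] using h3

lemma equation_iff (k : ℕ) (hk : 1 ≤ k) (f r g h : ℂ → ℂ) (hg : ∀ z, g z = r z ^ k) (z : ℂ)
    (hf : DifferentiableAt ℂ f z) (hr : DifferentiableAt ℂ r z) (h0 : r z ≠ 0) :
    (k : ℂ) * deriv f z * g z + f z * deriv g z = g z * h z ↔
      deriv (fun z => (k : ℂ) * (f z * r z)) z = r z * h z := by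
  have hgf : g = fun z => r z ^ k := funext hg
  have h1 : deriv g z = k * r z ^ (k - 1) * deriv r z := by
    rw [hgf]
    exact (hr.hasDerivAt.pow k).deriv
  have h2 : deriv (fun z => (k : ℂ) * (f z * r z)) z
      = k * (deriv f z * r z + f z * deriv r z) :=
    ((hf.hasDerivAt.mul hr.hasDerivAt).const_mul (k : ℂ)).deriv
  rw [h1, h2, hg]
  obtain ⟨m, rfl⟩ : ∃ m, k = m + 1 := ⟨k - 1, by omega⟩
  have hm : r z ^ m ≠ 0 := pow_ne_zero _ h0
  simp only [Nat.add_sub_cancel]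
  constructor
  · intro H
    apply mul_left_cancel₀ hm
    linear_combination H
  · intro H
    linear_combination r z ^ m * H

/-- For `k ≥ 1`, `r` meromorphic at `0` of order `b′ < 0`, `g = r^k`, and
`h` holomorphic near `0`: there is a holomorphic `f` on a ball `B(0,ρ)` with `f(0) = 0`
solving `k·f′·g + f·g′ = g·h` on the punctured ball iff `r·h` admits a primitive on
some punctured ball around `0`. -/
theorem stmt_4 (k : ℕ) (hk : 1 ≤ k) (b' : ℤ) (hb' : b' < 0) (r : ℂ → ℂ)
    (hr : MeromorphicAtZeroOfOrder r b')
    (g : ℂ → ℂ) (hg : ∀ z, g z = r z ^ k)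
    (h : ℂ → ℂ)
    (hh : ∃ ρ > (0 : ℝ), ∀ z ∈ Metric.ball (0 : ℂ) ρ, DifferentiableAt ℂ h z) :
    (∃ ρ > (0 : ℝ), ∃ f : ℂ → ℂ,
        (∀ z ∈ Metric.ball (0 : ℂ) ρ, DifferentiableAt ℂ f z) ∧ f 0 = 0 ∧
        ∀ z ∈ Metric.ball (0 : ℂ) ρ \ {0},
          (k : ℂ) * deriv f z * g z + f z * deriv g z = g z * h z) ↔
    (∃ ρ > (0 : ℝ), ∃ P : ℂ → ℂ,
        (∀ z ∈ Metric.ball (0 : ℂ) ρ \ {0}, DifferentiableAt ℂ P z) ∧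
        ∀ z ∈ Metric.ball (0 : ℂ) ρ \ {0}, deriv P z = r z * h z) := by
  obtain ⟨ρ₁, hρ₁, rt, hrt, hrt0, hre⟩ := hr
  obtain ⟨ρ₂, hρ₂, hh⟩ := hh
  obtain ⟨n, hn, rfl⟩ : ∃ n : ℕ, 1 ≤ n ∧ b' = -(n : ℤ) :=
    ⟨b'.natAbs, by omega, by omega⟩
  obtain ⟨ρ₃, hρ₃, hne⟩ : ∃ ρ > (0 : ℝ), ∀ z ∈ Metric.ball (0 : ℂ) ρ, rt z ≠ 0 := by
    have := (hrt 0 (by simpa using hρ₁)).continuousAt.eventually_ne hrt0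
    exact Metric.eventually_nhds_iff_ball.mp this
  have hrd : ∀ z ∈ Metric.ball (0 : ℂ) ρ₁ \ {0}, DifferentiableAt ℂ r z := by
    intro z hz
    have hz0 : z ≠ 0 := hz.2
    have hd : DifferentiableAt ℂ (fun z => z ^ (-(n : ℤ)) * rt z) z :=
      (differentiableAt_zpow.mpr (Or.inl hz0)).mul (hrt z hz.1)
    refine hd.congr_of_eventuallyEq ?_
    filter_upwards [(Metric.isOpen_ball.sdiff isClosed_singleton).mem_nhds hz] with w hw
      using hre w hw
  have hr0 : ∀ z ∈ Metric.ball (0 : ℂ) ρ₁ \ {0}, z ∈ Metric.ball (0 : ℂ) ρ₃ → r z ≠ 0 := by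
    intro z hz hz3
    rw [hre z hz]
    exact mul_ne_zero (zpow_ne_zero _ hz.2) (hne z hz3)
  constructor
  · rintro ⟨ρ, hρ, f, hf, -, hfe⟩
    refine ⟨min ρ (min ρ₁ ρ₃), by positivity, fun z => (k : ℂ) * (f z * r z), ?_, ?_⟩
    · rintro z ⟨hz, hz0⟩
      simp only [Metric.mem_ball, lt_inf_iff] at hz
      exact ((hf z hz.1).mul (hrd z ⟨hz.2.1, hz0⟩)).const_mul _
    · rintro z ⟨hz, hz0⟩
      simp only [Metric.mem_ball, lt_inf_iff] at hz
      exact (equation_iff k hk f r g h hg z (hf z hz.1) (hrd z ⟨hz.2.1, hz0⟩)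
        (hr0 z ⟨hz.2.1, hz0⟩ hz.2.2)).mp (hfe z ⟨hz.1, hz0⟩)
  · rintro ⟨ρ, hρ, P, hP, hPe⟩
    obtain ⟨δ, hδ, hδR, Q, hQd, hQ0, hQe⟩ := primitive_growth n hn (min ρ (min ρ₁ ρ₂))
      (by positivity) (fun z => rt z * h z) P
      (by
        intro z hz
        simp only [Metric.mem_ball, lt_inf_iff] at hz
        exact (hrt z hz.2.1).mul (hh z hz.2.2))
      (by
        rintro z ⟨hz, hz0⟩
        simp only [Metric.mem_ball, lt_inf_iff] at hz
        exact hP z ⟨hz.1, hz0⟩)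
      (by
        rintro z ⟨hz, hz0⟩
        simp only [Metric.mem_ball, lt_inf_iff] at hz
        have hz0' : z ≠ 0 := hz0
        rw [hPe z ⟨hz.1, hz0⟩, hre z ⟨hz.2.1, hz0⟩, zpow_neg, zpow_natCast]
        field_simp)
    have hk0 : (k : ℂ) ≠ 0 := by exact_mod_cast (by omega : k ≠ 0)
    have hfd : ∀ z ∈ Metric.ball (0 : ℂ) (min δ ρ₃),
        DifferentiableAt ℂ (fun z => Q z / (k * rt z)) z := by
      intro z hz
      simp only [Metric.mem_ball, lt_inf_iff] at hz
      have h1 : dist z 0 < min ρ (min ρ₁ ρ₂) := hz.1.trans_le hδR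
      simp only [lt_inf_iff] at h1
      exact (hQd z hz.1).div ((hrt z h1.2.1).const_mul _)
        (mul_ne_zero hk0 (hne z hz.2))
    refine ⟨min δ ρ₃, by positivity, fun z => Q z / (k * rt z), hfd, by simp [hQ0], ?_⟩
    rintro z hzz
    obtain ⟨hz, hz0⟩ := hzz
    have hd := hfd z hz
    have hz' := hz
    simp only [Metric.mem_ball, lt_inf_iff] at hz
    have h1 : dist z 0 < min ρ (min ρ₁ ρ₂) := hz.1.trans_le hδR
    simp only [lt_inf_iff] at h1
    refine (equation_iff k hk _ r g h hg z hd (hrd z ⟨h1.2.1, hz0⟩)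
        (hr0 z ⟨h1.2.1, hz0⟩ hz.2)).mpr ?_
    rw [← hPe z ⟨h1.1, hz0⟩]
    apply Filter.EventuallyEq.deriv_eq
    filter_upwards [(Metric.isOpen_ball.sdiff isClosed_singleton).mem_nhds
      (show z ∈ Metric.ball (0 : ℂ) (min δ ρ₃) \ {0} from ⟨hz', hz0⟩)] with w hw
    obtain ⟨hw, hw0⟩ := hw
    have hw0' : w ≠ 0 := hw0
    simp only [Metric.mem_ball, lt_inf_iff] at hw
    have h2 : dist w 0 < min ρ (min ρ₁ ρ₂) := hw.1.trans_le hδR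
    simp only [lt_inf_iff] at h2
    have h3 := hne w hw.2
    rw [hQe w ⟨hw.1, hw0⟩, hre w ⟨h2.2.1, hw0⟩, zpow_neg, zpow_natCast]
    field_simp
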